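/- arXiv:1612.07780 — 5 statements merged into one kernel-verified Lean document; each statement's English description precedes it below -/
import Mathlib

section
/- Let α₁, α₂ ∈ (0,2) and δ ∈ (0,1). Then, uniformly in the region {(s,t) ∈ ℝ² : |s| ≤ 1−δ}, as |s|^{α₁} + |t|^{α₂} → 1 from below one has 1 − √(|s|^{α₁}+|t|^{α₂}) ∼ (α₂/2)(1−|s|^{α₁})^{1−1/α₂}((1−|s|^{α₁})^{1/α₂} − |t|). Precisely: for every ε > 0 there exists η ∈ (0,1) such that for all (s,t) ∈ ℝ² with |s| ≤ 1−δ and 1−η ≤ |s|^{α₁}+|t|^{α₂} < 1, one has |(1 − √(|s|^{α₁}+|t|^{α₂})) / ((α₂/2)(1−|s|^{α₁})^{1−1/α₂}((1−|s|^{α₁})^{1/α₂} − |t|)) − 1| ≤ ε. -/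
/-- Uniformly in `{(s,t) : |s| ≤ 1-δ}`, as `|s|^{α₁}+|t|^{α₂} → 1⁻`,
`1 - √(|s|^{α₁}+|t|^{α₂}) ∼ (α₂/2)(1-|s|^{α₁})^{1-1/α₂}((1-|s|^{α₁})^{1/α₂} - |t|)`. -/
theorem stmt0 (α₁ α₂ δ : ℝ) (hα₁ : α₁ ∈ Set.Ioo (0:ℝ) 2) (hα₂ : α₂ ∈ Set.Ioo (0:ℝ) 2)
    (hδ : δ ∈ Set.Ioo (0:ℝ) 1) :
    ∀ ε > (0:ℝ), ∃ η ∈ Set.Ioo (0:ℝ) 1, ∀ s t : ℝ,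
      |s| ≤ 1 - δ → 1 - η ≤ |s| ^ α₁ + |t| ^ α₂ → |s| ^ α₁ + |t| ^ α₂ < 1 →
      |(1 - Real.sqrt (|s| ^ α₁ + |t| ^ α₂)) /
          ((α₂ / 2) * (1 - |s| ^ α₁) ^ (1 - 1 / α₂) * ((1 - |s| ^ α₁) ^ (1 / α₂) - |t|))
        - 1| ≤ ε := by
  obtain ⟨h1, -⟩ := hα₁
  obtain ⟨h2, -⟩ := hα₂
  obtain ⟨hd, hd1⟩ := hδ
  intro ε hε
  have hF : Filter.Tendsto (fun r : ℝ => 2 / (1 + Real.sqrt r)) (nhds 1) (nhds 1) := by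
    have : ContinuousAt (fun r : ℝ => 2 / (1 + Real.sqrt r)) 1 := by
      apply ContinuousAt.div continuousAt_const
      · exact continuousAt_const.add Real.continuous_sqrt.continuousAt
      · simp
    have h := this.tendsto
    norm_num at h
    exact h
  have hG : Filter.Tendsto (fun y : ℝ => (1 / α₂) / slope (fun y : ℝ => y ^ (1 / α₂)) 1 y)
      (nhdsWithin 1 {1}ᶜ) (nhds 1) := by
    have h := (Real.hasDerivAt_rpow_const (x := 1) (p := 1 / α₂) (Or.inl one_ne_zero)).tendsto_slope
    rw [Real.one_rpow, mul_one] at h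
    have h3 : (1 / α₂) ≠ 0 := by positivity
    have h4 := (tendsto_const_nhds (x := 1 / α₂)).div h h3
    rw [div_self h3] at h4
    exact h4
  obtain ⟨η₁, hη₁, hFG⟩ : ∃ η₁ > (0:ℝ), ∀ r y : ℝ, |r - 1| < η₁ → |y - 1| < η₁ → y ≠ 1 →
      |2 / (1 + Real.sqrt r) * ((1 / α₂) / slope (fun y : ℝ => y ^ (1 / α₂)) 1 y) - 1| < ε := by
    have h := (hF.comp Filter.tendsto_fst).mul (hG.comp (Filter.tendsto_snd (f := nhds (1:ℝ))))
    rw [mul_one] at h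
    have h5 := (Metric.tendsto_nhds.1 h) ε hε
    obtain ⟨pa, ha, pb, hb, hab⟩ := Filter.eventually_prod_iff.1 h5
    obtain ⟨e1, he1, H1⟩ := Metric.eventually_nhds_iff.1 ha
    obtain ⟨e2, he2, H2⟩ := Metric.eventually_nhds_iff.1 (eventually_nhdsWithin_iff.1 hb)
    refine ⟨min e1 e2, lt_min he1 he2, fun r y hr hy hy1 => ?_⟩
    exact hab (H1 (lt_of_lt_of_le hr (min_le_left _ _)))
      (H2 (lt_of_lt_of_le hy (min_le_right _ _)) hy1)
  set c : ℝ := 1 - (1 - δ) ^ α₁ with hc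
  have hc0 : 0 < c := by
    have := Real.rpow_lt_one (x := 1 - δ) (z := α₁) (by linarith) (by linarith) h1
    linarith
  have hc1 : c ≤ 1 := by
    have := Real.rpow_nonneg (x := 1 - δ) (by linarith) α₁
    linarith
  have hm : 0 < η₁ * c / 2 := by positivity
  refine ⟨min (1 / 2) (η₁ * c / 2), ⟨lt_min (by norm_num) hm,
    lt_of_le_of_lt (min_le_left _ _) (by norm_num)⟩, fun s t hs hr0 hr1 => ?_⟩
  have hη := min_le_right (1 / 2 : ℝ) (η₁ * c / 2)
  have hη' := min_le_left (1 / 2 : ℝ) (η₁ * c / 2)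
  have hsc : |s| ^ α₁ ≤ (1 - δ) ^ α₁ := Real.rpow_le_rpow (abs_nonneg _) hs h1.le
  have hs0 : 0 ≤ |s| ^ α₁ := Real.rpow_nonneg (abs_nonneg _) _
  have ht0 : 0 ≤ |t| ^ α₂ := Real.rpow_nonneg (abs_nonneg _) _
  obtain ⟨a, ha⟩ : ∃ a, a = 1 - |s| ^ α₁ := ⟨_, rfl⟩
  have hac : c ≤ a := by linarith
  have ha0 : 0 < a := by linarith
  obtain ⟨r, hr⟩ : ∃ r, r = |s| ^ α₁ + |t| ^ α₂ := ⟨_, rfl⟩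
  obtain ⟨y, hy⟩ : ∃ y, y = |t| ^ α₂ / a := ⟨_, rfl⟩
  have hya : a * y = |t| ^ α₂ := by rw [hy]; field_simp
  have hy0 : 0 ≤ y := by rw [hy]; positivity
  have hy1 : y < 1 := by rw [hy, div_lt_one ha0]; linarith
  have hra : 1 - r = a * (1 - y) := by rw [mul_sub, hya, hr, ha]; ring
  have hx : a ^ (1 / α₂) * y ^ (1 / α₂) = |t| := by
    rw [← Real.mul_rpow ha0.le hy0, hya, one_div, Real.rpow_rpow_inv (abs_nonneg _) h2.ne']
  have hcy : c * (1 - y) ≤ η₁ * c / 2 := by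
    have : c * (1 - y) ≤ a * (1 - y) := mul_le_mul_of_nonneg_right hac (by linarith)
    linarith
  have hy2 : 1 - y < η₁ := by
    by_contra! hcon
    have := mul_le_mul_of_nonneg_left hcon hc0.le
    nlinarith
  have hr2 : 1 - r < η₁ := by nlinarith
  have key := hFG r y (by rw [abs_lt]; constructor <;> linarith)
    (by rw [abs_lt]; constructor <;> linarith) hy1.ne
  rw [← hr, ← ha, ← hx]
  refine le_of_eq_of_le ?_ key.le
  congr 2
  have hsp : a ^ (1 - 1 / α₂) * a ^ (1 / α₂) = a := by
    rw [← Real.rpow_add ha0]; simp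
  have hY : y ^ (1 / α₂) < 1 := Real.rpow_lt_one hy0 hy1 (by positivity)
  have hden : α₂ / 2 * a ^ (1 - 1 / α₂) * (a ^ (1 / α₂) - a ^ (1 / α₂) * y ^ (1 / α₂))
      = α₂ / 2 * a * (1 - y ^ (1 / α₂)) := by
    linear_combination (α₂ / 2 * (1 - y ^ (1 / α₂))) * hsp
  have hrn : 0 ≤ r := by linarith
  have hq0 := Real.sqrt_nonneg r
  have hqq := Real.sq_sqrt hrn
  rw [hden, slope_def_field, Real.one_rpow]
  generalize y ^ (1 / α₂) = Y at *
  generalize Real.sqrt r = q at *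
  have e1 : (1:ℝ) - Y ≠ 0 := by linarith
  have e2 : Y - 1 ≠ 0 := by linarith
  have e3 : (1:ℝ) + q ≠ 0 := by linarith
  have e4 : y - 1 ≠ 0 := by linarith
  have e5 : 1 - q = a * (1 - y) / (1 + q) := by
    rw [eq_div_iff e3]; linear_combination hra - hqq
  rw [e5]
  have e6 : (1:ℝ) - Y = -(Y - 1) := by ring
  rw [e6]
  field_simp
  ring
end

section
/- Let α₁, α₂ ∈ (0,2) and δ ∈ (0,1). Then, uniformly in the region {(s,t) ∈ ℝ² : |t| ≤ 1−δ}, as |s|^{α₁} + |t|^{α₂} → 1 from below one has 1 − √(|s|^{α₁}+|t|^{α₂}) ∼ (α₁/2)(1−|t|^{α₂})^{1−1/α₁}((1−|t|^{α₂})^{1/α₁} − |s|). Precisely: for every ε > 0 there exists η ∈ (0,1) such that for all (s,t) ∈ ℝ² with |t| ≤ 1−δ and 1−η ≤ |s|^{α₁}+|t|^{α₂} < 1, one has |(1 − √(|s|^{α₁}+|t|^{α₂})) / ((α₁/2)(1−|t|^{α₂})^{1−1/α₁}((1−|t|^{α₂})^{1/α₁} − |s|)) − 1| ≤ ε. -/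
lemma aux_G (p : ℝ) (hp : 0 < p) :
    Filter.Tendsto (fun u : ℝ => p * u / (1 - (1 - u) ^ p)) (nhdsWithin 0 (Set.Ioi 0)) (nhds 1) := by
  have h1 : HasDerivAt (fun u : ℝ => (1 - u) ^ p) (-p) 0 := by
    have h2 : HasDerivAt (fun u : ℝ => 1 - u) (-1) 0 := by
      simpa using (hasDerivAt_id (0:ℝ)).const_sub 1
    have h3 := h2.rpow_const (p := p) (Or.inl (by norm_num))
    simpa using h3
  have h4 := (hasDerivAt_iff_tendsto_slope.1 h1).mono_left
    (nhdsGT_le_nhdsNE 0)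
  have h5 := (h4.inv₀ (by linarith)).const_mul (-p)
  rw [mul_inv_cancel₀ (by linarith)] at h5
  refine h5.congr (fun u => ?_)
  simp only [slope_def_field, sub_zero, Real.one_rpow, inv_div]
  rw [← neg_sub (1:ℝ) ((1-u)^p), div_neg]
  ring

lemma aux_F :
    Filter.Tendsto (fun h : ℝ => 2 / (1 + Real.sqrt (1 - h))) (nhds 0) (nhds 1) := by
  have : ContinuousAt (fun h : ℝ => 2 / (1 + Real.sqrt (1 - h))) 0 := by
    apply ContinuousAt.div (by fun_prop) (by fun_prop)
    positivity
  have h := this.tendsto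
  norm_num at h
  exact h

/-- Uniformly in `{(s,t) : |t| ≤ 1-δ}`, as `|s|^{α₁}+|t|^{α₂} → 1⁻`,
`1 - √(|s|^{α₁}+|t|^{α₂}) ∼ (α₁/2)(1-|t|^{α₂})^{1-1/α₁}((1-|t|^{α₂})^{1/α₁} - |s|)`. -/
theorem stmt1 (α₁ α₂ δ : ℝ) (hα₁ : α₁ ∈ Set.Ioo (0:ℝ) 2) (hα₂ : α₂ ∈ Set.Ioo (0:ℝ) 2)
    (hδ : δ ∈ Set.Ioo (0:ℝ) 1) :
    ∀ ε > (0:ℝ), ∃ η ∈ Set.Ioo (0:ℝ) 1, ∀ s t : ℝ,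
      |t| ≤ 1 - δ → 1 - η ≤ |s| ^ α₁ + |t| ^ α₂ → |s| ^ α₁ + |t| ^ α₂ < 1 →
      |(1 - Real.sqrt (|s| ^ α₁ + |t| ^ α₂)) /
          ((α₁ / 2) * (1 - |t| ^ α₂) ^ (1 - 1 / α₁) * ((1 - |t| ^ α₂) ^ (1 / α₁) - |s|))
        - 1| ≤ ε := by
  intro ε hε
  obtain ⟨ha, -⟩ := hα₁
  obtain ⟨hb, -⟩ := hα₂
  obtain ⟨hd0, hd1⟩ := hδ
  have hp : 0 < 1 / α₁ := by positivity
  have hT := (aux_F.comp Filter.tendsto_fst).mul ((aux_G (1/α₁) hp).comp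
    (Filter.tendsto_snd (f := nhds (0:ℝ))))
  rw [one_mul] at hT
  have hE := hT.eventually (Metric.ball_mem_nhds 1 hε)
  obtain ⟨P, hP, Q, hQ, hPQ⟩ := Filter.eventually_prod_iff.1 hE
  obtain ⟨r, hr, hrP⟩ := Metric.eventually_nhds_iff.1 hP
  obtain ⟨q, hq, hqQ⟩ := mem_nhdsGT_iff_exists_Ioo_subset.1 hQ
  have hq : 0 < q := hq
  set c := 1 - (1 - δ) ^ α₂ with hc
  have hc0 : 0 < c := by
    have := Real.rpow_lt_one (x := 1 - δ) (by linarith) (by linarith) hb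
    linarith
  refine ⟨min (1/2) (min (r/2) (c * q / 2)), ⟨by positivity, ?_⟩, ?_⟩
  · exact lt_of_le_of_lt (min_le_left _ _) (by norm_num)
  intro s t ht h1 h2
  obtain ⟨h, hh⟩ : ∃ h, h = 1 - (|s| ^ α₁ + |t| ^ α₂) := ⟨_, rfl⟩
  have hle : h ≤ min (1/2) (min (r/2) (c * q / 2)) := by linarith
  have hlr : h ≤ r / 2 := hle.trans ((min_le_right _ _).trans (min_le_left _ _))
  have hlq : h ≤ c * q / 2 := hle.trans ((min_le_right _ _).trans (min_le_right _ _))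
  have hh0 : 0 < h := by linarith
  have hs0 : 0 ≤ |s| ^ α₁ := by positivity
  have hcA : c ≤ 1 - |t| ^ α₂ := by
    have := Real.rpow_le_rpow (abs_nonneg t) ht hb.le
    linarith
  obtain ⟨A, hA⟩ : ∃ A, A = 1 - |t| ^ α₂ := ⟨_, rfl⟩
  rw [← hA] at hcA ⊢
  have hA0 : 0 < A := by linarith
  obtain ⟨u, hu⟩ : ∃ u, u = h / A := ⟨_, rfl⟩
  have hu0 : 0 < u := by rw [hu]; positivity
  have huA : h = u * A := by rw [hu]; field_simp
  have hu1 : u ≤ 1 := by rw [hu, div_le_one hA0]; linarith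
  have huq : u < q := by
    rw [hu, div_lt_iff₀ hA0]; nlinarith
  have hsA : |s| ^ α₁ = A * (1 - u) := by linarith
  have hs : |s| = A ^ (1/α₁) * (1 - u) ^ (1/α₁) := by
    rw [← Real.mul_rpow hA0.le (by linarith), ← hsA, one_div, Real.rpow_rpow_inv (abs_nonneg s) ha.ne']
  have key := hPQ (x := h) (hrP (by rw [Real.dist_eq, sub_zero, abs_of_pos hh0]; linarith))
    (y := u) (hqQ ⟨hu0, huq⟩)
  have key' : |2 / (1 + Real.sqrt (1 - h)) * (1/α₁ * u / (1 - (1 - u) ^ (1/α₁))) - 1| < ε := key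
  have hw : (1 - u) ^ (1/α₁) < 1 := Real.rpow_lt_one (by linarith) (by linarith) hp
  have hAA : A ^ (1 - 1/α₁) * A ^ (1/α₁) = A := by
    rw [← Real.rpow_add hA0]; simp
  have hden : (α₁ / 2) * A ^ (1 - 1 / α₁) * (A ^ (1 / α₁) - |s|)
      = α₁ / 2 * A * (1 - (1 - u) ^ (1/α₁)) := by
    rw [hs]
    linear_combination (α₁ / 2 * (1 - (1 - u) ^ (1/α₁))) * hAA
  have hR : |s| ^ α₁ + |t| ^ α₂ = 1 - h := by linarith
  rw [hden, hR]
  have hsq : Real.sqrt (1 - h) ^ 2 = 1 - h := Real.sq_sqrt (by linarith [Real.rpow_nonneg (abs_nonneg t) α₂])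
  have hsn := Real.sqrt_nonneg (1 - h)
  refine le_of_eq_of_le ?_ key'.le
  congr 2
  have hw' : 1 - (1 - u) ^ (1/α₁) ≠ 0 := by linarith
  generalize (1 - u) ^ (1/α₁) = w at *
  generalize Real.sqrt (1 - h) = v at *
  have hv : 1 + v ≠ 0 := by positivity
  have e : (1 - v) * (1 + v) = u * A := by linarith
  rw [div_mul_div_comm, div_eq_div_iff (by positivity) (by positivity)]
  field_simp
  linear_combination e
end

section
/- Let α₁, α₂ ∈ (0,2). For (s,t), (s₁,t₁) ∈ ℝ² with |s|^{α₁}+|t|^{α₂} > 0 and |s₁|^{α₁}+|t₁|^{α₂} > 0, define r(s,t,s₁,t₁) := (|s|^{α₁}+|s₁|^{α₁}−|s−s₁|^{α₁} + |t|^{α₂}+|t₁|^{α₂}−|t−t₁|^{α₂}) / (2 √(|s|^{α₁}+|t|^{α₂}) √(|s₁|^{α₁}+|t₁|^{α₂})). Then lim_{δ→0⁺} sup { |2(1−r(s,t,s₁,t₁)) / (|s−s₁|^{α₁}+|t−t₁|^{α₂}) − 1| : (s,t) ≠ (s₁,t₁), |s−s₁| ≤ δ, |t−t₁| ≤ δ,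 1−δ ≤ |s|^{α₁}+|t|^{α₂} ≤ 1, 1−δ ≤ |s₁|^{α₁}+|t₁|^{α₂} ≤ 1 } = 0. -/
/-- The correlation function of the field `B_{α₁}(s) + B_{α₂}(t)`. -/
noncomputable def corrFBMsum (α₁ α₂ s t s₁ t₁ : ℝ) : ℝ :=
  (|s| ^ α₁ + |s₁| ^ α₁ - |s - s₁| ^ α₁ + |t| ^ α₂ + |t₁| ^ α₂ - |t - t₁| ^ α₂) /
    (2 * Real.sqrt (|s| ^ α₁ + |t| ^ α₂) * Real.sqrt (|s₁| ^ α₁ + |t₁| ^ α₂))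

theorem aux_lip (α : ℝ) (h1 : 1 ≤ α) (h2 : α < 2) (a b : ℝ) (hb : 0 ≤ b) (hab : b ≤ a)
    (ha : a ≤ 1) : a ^ α - b ^ α ≤ 2 * (a - b) := by
  rcases eq_or_lt_of_le (hb.trans hab) with h0 | h0
  · have : b = a := by linarith
    subst this
    simp
  have hq : 0 ≤ b / a := by positivity
  have h := one_add_mul_self_le_rpow_one_add (s := b / a - 1) (by linarith) h1
  rw [show 1 + (b / a - 1) = b / a by ring, Real.div_rpow hb h0.le] at h
  have hp : 0 < a ^ α := Real.rpow_pos_of_pos h0 α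
  rw [le_div_iff₀ hp] at h
  have hpa : a ^ α ≤ a := by
    simpa using Real.rpow_le_rpow_of_exponent_ge h0 ha h1
  have hq1 : 0 ≤ 1 - b / a := by
    have := (div_le_one h0).2 hab
    linarith
  have e : a * (1 - b / a) = a - b := by field_simp
  have h3 : a ^ α * (1 - b / a) ≤ a - b := by
    rw [← e]; exact mul_le_mul_of_nonneg_right hpa hq1
  have h5 : α * (a ^ α * (1 - b / a)) ≤ 2 * (a - b) :=
    mul_le_mul h2.le h3 (by positivity) (by norm_num)
  nlinarith

theorem aux_hold (α : ℝ) (h0 : 0 < α) (h1 : α ≤ 1) (a b : ℝ) (hb : 0 ≤ b) (hab : b ≤ a) :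
    a ^ α - b ^ α ≤ (a - b) ^ α := by
  have := Real.rpow_add_le_add_rpow hb (sub_nonneg.2 hab) h0.le h1
  rw [show b + (a - b) = a by ring] at this
  linarith

theorem aux_core (α : ℝ) (hα : α ∈ Set.Ioo (0:ℝ) 2) : ∃ c > (0:ℝ), ∀ a b : ℝ, 0 ≤ b → b ≤ a →
    a ≤ 1 → (a ^ α - b ^ α) ^ 2 ≤ 4 * ((a - b) ^ c * (a - b) ^ α) := by
  obtain ⟨h0, h2⟩ := hα
  rcases le_total α 1 with h1 | h1
  · refine ⟨α, h0, fun a b hb hab ha => ?_⟩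
    have h := aux_hold α h0 h1 a b hb hab
    have hn : 0 ≤ a ^ α - b ^ α := sub_nonneg.2 (Real.rpow_le_rpow hb hab h0.le)
    nlinarith
  · refine ⟨2 - α, by linarith, fun a b hb hab ha => ?_⟩
    have h := aux_lip α h1 h2 a b hb hab ha
    have hn : 0 ≤ a ^ α - b ^ α := sub_nonneg.2 (Real.rpow_le_rpow hb hab h0.le)
    rw [← Real.rpow_add' (sub_nonneg.2 hab) (by norm_num), show 2 - α + α = (2:ℝ) by ring,
      Real.rpow_two]
    nlinarith

theorem aux_eta (α : ℝ) (hα : α ∈ Set.Ioo (0:ℝ) 2) (η : ℝ) (hη : 0 < η) : ∃ δ > (0:ℝ),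
    ∀ a b : ℝ, |a| ^ α ≤ 1 → |b| ^ α ≤ 1 → |a - b| ≤ δ →
    (|a| ^ α - |b| ^ α) ^ 2 ≤ η * |a - b| ^ α := by
  obtain ⟨c, hc, H⟩ := aux_core α hα
  have key : ∀ x y : ℝ, 0 ≤ y → y ≤ x → x ≤ 1 → ∀ h : ℝ, x - y ≤ h → h ≤ (η / 4) ^ (1 / c) →
      (x ^ α - y ^ α) ^ 2 ≤ η * h ^ α := by
    intro x y hy hyx hx h hh hd
    have hxy : 0 ≤ x - y := sub_nonneg.2 hyx
    have h1 : (x - y) ^ c ≤ η / 4 := by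
      have := Real.rpow_le_rpow hxy (hh.trans hd) hc.le
      rwa [← Real.rpow_mul (by positivity), one_div_mul_cancel hc.ne', Real.rpow_one] at this
    have h2 : (x - y) ^ α ≤ h ^ α := Real.rpow_le_rpow hxy hh hα.1.le
    have h3 := mul_le_mul h1 h2 (Real.rpow_nonneg hxy α) (by positivity)
    have := H x y hy hyx hx
    linarith
  refine ⟨(η / 4) ^ (1 / c), by positivity, fun a b ha hb hd => ?_⟩
  have le1 : ∀ z : ℝ, |z| ^ α ≤ 1 → |z| ≤ 1 := by
    intro z hz
    by_contra hcon
    have := Real.one_lt_rpow (not_le.1 hcon) hα.1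
    linarith
  rcases le_total |b| |a| with h | h
  · exact key _ _ (abs_nonneg b) h (le1 a ha) _ (abs_sub_abs_le_abs_sub a b) hd
  · have := key _ _ (abs_nonneg a) h (le1 b hb) (|a - b|)
      (by rw [abs_sub_comm]; exact abs_sub_abs_le_abs_sub b a) hd
    nlinarith

theorem aux_final (ε δ A B D : ℝ) (hε : 0 < ε) (hδ2 : δ ≤ 1 / 2)
    (hδε : δ ≤ ε / 2) (hA : 1 - δ ≤ A) (hA1 : A ≤ 1) (hB : 1 - δ ≤ B) (hB1 : B ≤ 1)
    (hD : 0 < D) (h : (A - B) ^ 2 ≤ ε / 2 * D) :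
    |2 * (1 - (A + B - D) / (2 * Real.sqrt A * Real.sqrt B)) / D - 1| ≤ ε := by
  have hA0 : 0 < A := by linarith
  have hB0 : 0 < B := by linarith
  obtain ⟨p, hp⟩ : ∃ p, p = Real.sqrt A := ⟨_, rfl⟩
  obtain ⟨q, hq⟩ : ∃ q, q = Real.sqrt B := ⟨_, rfl⟩
  have hp0 : 0 < p := hp ▸ Real.sqrt_pos.2 hA0
  have hq0 : 0 < q := hq ▸ Real.sqrt_pos.2 hB0
  have hpA : p ^ 2 = A := by rw [hp]; exact Real.sq_sqrt hA0.le
  have hqB : q ^ 2 = B := by rw [hq]; exact Real.sq_sqrt hB0.le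
  rw [← hp, ← hq]
  have hpq1 : p * q ≤ 1 := by nlinarith [sq_nonneg (p - q)]
  have hpqd : 1 - δ ≤ p * q := by
    refine abs_le_of_sq_le_sq' ?_ (by positivity) |>.2
    · rw [mul_pow, hpA, hqB]
      nlinarith
  have hpq2 : 1 / 2 ≤ p * q := by linarith
  have e : 2 * (1 - (A + B - D) / (2 * p * q)) / D - 1
      = ((1 - p * q) * D - (p - q) ^ 2) / (p * q * D) := by
    rw [← hpA, ← hqB]
    field_simp
    ring
  have hsum : 1 ≤ (p + q) ^ 2 := by nlinarith
  have hE : (p - q) ^ 2 ≤ ε / 2 * D := by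
    have : (A - B) ^ 2 = (p - q) ^ 2 * (p + q) ^ 2 := by rw [← hpA, ← hqB]; ring
    nlinarith [sq_nonneg (p - q)]
  have hm : ε / 2 * D ≤ ε * (p * q * D) := by
    nlinarith [mul_pos hε hD]
  rw [e, abs_le]
  constructor
  · rw [le_div_iff₀ (by positivity)]
    nlinarith [mul_nonneg (sub_nonneg.2 hpq1) hD.le]
  · rw [div_le_iff₀ (by positivity)]
    nlinarith [mul_le_mul_of_nonneg_right (show 1 - p * q ≤ ε / 2 by linarith) hD.le,
      sq_nonneg (p - q)]

/-- `lim_{δ→0⁺} sup |2(1-r)/(|s-s₁|^{α₁}+|t-t₁|^{α₂}) - 1| = 0` over the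
region `(s,t) ≠ (s₁,t₁)`, `|s-s₁| ≤ δ`, `|t-t₁| ≤ δ`, `1-δ ≤ |s|^{α₁}+|t|^{α₂} ≤ 1`,
`1-δ ≤ |s₁|^{α₁}+|t₁|^{α₂} ≤ 1`. -/
theorem stmt2 (α₁ α₂ : ℝ) (hα₁ : α₁ ∈ Set.Ioo (0:ℝ) 2) (hα₂ : α₂ ∈ Set.Ioo (0:ℝ) 2) :
    ∀ ε > (0:ℝ), ∃ δ > (0:ℝ), ∀ s t s₁ t₁ : ℝ,
      (s, t) ≠ (s₁, t₁) → |s - s₁| ≤ δ → |t - t₁| ≤ δ →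
      1 - δ ≤ |s| ^ α₁ + |t| ^ α₂ → |s| ^ α₁ + |t| ^ α₂ ≤ 1 →
      1 - δ ≤ |s₁| ^ α₁ + |t₁| ^ α₂ → |s₁| ^ α₁ + |t₁| ^ α₂ ≤ 1 →
      |2 * (1 - corrFBMsum α₁ α₂ s t s₁ t₁) / (|s - s₁| ^ α₁ + |t - t₁| ^ α₂) - 1| ≤ ε := by
  intro ε hε
  obtain ⟨d1, hd1, H1⟩ := aux_eta α₁ hα₁ (ε / 4) (by positivity)
  obtain ⟨d2, hd2, H2⟩ := aux_eta α₂ hα₂ (ε / 4) (by positivity)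
  refine ⟨min (min d1 d2) (min (1 / 2) (ε / 2)), by positivity, ?_⟩
  intro s t s₁ t₁ hne hs ht hA hA1 hB hB1
  obtain ⟨δ, hδ⟩ : ∃ δ, δ = min (min d1 d2) (min (1 / 2) (ε / 2)) := ⟨_, rfl⟩
  rw [← hδ] at hs ht hA hB
  have l1 : δ ≤ d1 := by rw [hδ]; exact (min_le_left _ _).trans (min_le_left _ _)
  have l2 : δ ≤ d2 := by rw [hδ]; exact (min_le_left _ _).trans (min_le_right _ _)
  have l3 : δ ≤ 1 / 2 := by rw [hδ]; exact (min_le_right _ _).trans (min_le_left _ _)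
  have l4 : δ ≤ ε / 2 := by rw [hδ]; exact (min_le_right _ _).trans (min_le_right _ _)
  have n1 : 0 ≤ |s| ^ α₁ := by positivity
  have n2 : 0 ≤ |t| ^ α₂ := by positivity
  have n3 : 0 ≤ |s₁| ^ α₁ := by positivity
  have n4 : 0 ≤ |t₁| ^ α₂ := by positivity
  have x1 := H1 s s₁ (by linarith) (by linarith) (hs.trans l1)
  have x2 := H2 t t₁ (by linarith) (by linarith) (ht.trans l2)
  have hD : 0 < |s - s₁| ^ α₁ + |t - t₁| ^ α₂ := by
    by_cases hss : s = s₁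
    · have htt : t - t₁ ≠ 0 := fun h => hne (by rw [hss, sub_eq_zero.1 h])
      have : 0 < |t - t₁| ^ α₂ := Real.rpow_pos_of_pos (abs_pos.2 htt) _
      positivity
    · have : 0 < |s - s₁| ^ α₁ := Real.rpow_pos_of_pos (abs_pos.2 (sub_ne_zero.2 hss)) _
      positivity
  have key := aux_final ε δ _ _ _ hε l3 l4 hA hA1 hB hB1 hD
    (by nlinarith [sq_nonneg ((|s| ^ α₁ - |s₁| ^ α₁) - (|t| ^ α₂ - |t₁| ^ α₂))])
  unfold corrFBMsum
  convert key using 7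
  ring
end

section
/- Let α₁, α₂ ∈ (0,2) and let ε be a real number with 0 < ε < min(α₁, α₂, 2−α₁, 2−α₂). Then there exists a constant C > 0 such that for all (s,t), (s',t') ∈ ℝ² satisfying 1/2 ≤ |s|^{α₁}+|t|^{α₂} ≤ 1, 1/2 ≤ |s'|^{α₁}+|t'|^{α₂} ≤ 1 and (s,t) ≠ (s',t'), one has (√(|s|^{α₁}+|t|^{α₂}) − √(|s'|^{α₁}+|t'|^{α₂}))² ≤ C (|s−s'|^{ε} + |t−t'|^{ε}) (|s−s'|^{α₁} + |t−t'|^{α₂}). -/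
theorem aux_ord (α ε a b : ℝ) (h0 : 0 < α) (h2 : α < 2) (hε : 0 < ε) (h1 : ε < α)
    (h3 : ε < 2 - α) (hb : 0 ≤ b) (hab : b ≤ a) (ha : a ≤ 1) :
    (a ^ α - b ^ α) ^ 2 ≤ 4 * (a - b) ^ (α + ε) := by
  rcases hab.eq_or_lt with rfl | hlt
  · simp [Real.zero_rpow (by linarith : α + ε ≠ 0)]
  have ha0 : 0 < a := by linarith
  have hd : 0 < a - b := by linarith
  have hd1 : a - b ≤ 1 := by linarith
  have hm : 0 ≤ a ^ α - b ^ α := sub_nonneg.2 (Real.rpow_le_rpow hb hab h0.le)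
  rcases le_total α 1 with h | h
  · have k : a ^ α ≤ (a - b) ^ α + b ^ α := by
      have := Real.rpow_add_le_add_rpow hd.le hb h0.le h
      simpa using this
    have k2 : (a ^ α - b ^ α) ^ 2 ≤ ((a - b) ^ α) ^ 2 :=
      pow_le_pow_left₀ hm (by linarith) 2
    have k3 : ((a - b) ^ α) ^ 2 = (a - b) ^ (α + α) := by
      rw [Real.rpow_add hd]; ring
    have k4 : (a - b) ^ (α + α) ≤ (a - b) ^ (α + ε) :=
      Real.rpow_le_rpow_of_exponent_ge hd hd1 (by linarith)
    have : 0 ≤ (a - b) ^ (α + ε) := by positivity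
    linarith
  · have k0 : 1 + α * (b / a - 1) ≤ (1 + (b / a - 1)) ^ α :=
      one_add_mul_self_le_rpow_one_add (by have : 0 ≤ b / a := by positivity
                                           linarith) h
    have k1 : (1 + (b / a - 1)) ^ α = b ^ α / a ^ α := by
      rw [add_sub_cancel, Real.div_rpow hb ha0.le]
    rw [k1] at k0
    have pa : 0 < a ^ α := by positivity
    rw [le_div_iff₀ pa] at k0
    have k5 : a ^ α ≤ a := by
      simpa using Real.rpow_le_rpow_of_exponent_ge ha0 ha h
    have k6 : a ^ α - b ^ α ≤ α * ((a - b) / a) * a ^ α := by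
      have : b / a - 1 = - ((a - b) / a) := by field_simp; ring
      rw [this] at k0
      linarith
    have k7 : α * ((a - b) / a) * a ^ α ≤ α * ((a - b) / a) * a := by gcongr
    have k8 : α * ((a - b) / a) * a = α * (a - b) := by field_simp
    have k9 : a ^ α - b ^ α ≤ 2 * (a - b) := by nlinarith
    have k2 : (a ^ α - b ^ α) ^ 2 ≤ (2 * (a - b)) ^ 2 :=
      pow_le_pow_left₀ hm k9 2
    have k4 : (a - b) ^ (2:ℝ) ≤ (a - b) ^ (α + ε) :=
      Real.rpow_le_rpow_of_exponent_ge hd hd1 (by linarith)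
    rw [Real.rpow_two] at k4
    nlinarith

theorem aux_abs (α ε s s' : ℝ) (h0 : 0 < α) (h2 : α < 2) (hε : 0 < ε) (h1 : ε < α)
    (h3 : ε < 2 - α) (hs : |s| ^ α ≤ 1) (hs' : |s'| ^ α ≤ 1) :
    (|s| ^ α - |s'| ^ α) ^ 2 ≤ 4 * (|s - s'| ^ ε * |s - s'| ^ α) := by
  have key : ∀ x y : ℝ, |x| ^ α ≤ 1 → |y| ≤ |x| →
      (|x| ^ α - |y| ^ α) ^ 2 ≤ 4 * (|x - y| ^ ε * |x - y| ^ α) := by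
    intro x y hx hxy
    have hx1 : |x| ≤ 1 := by
      by_contra hc
      have := Real.one_lt_rpow (not_le.1 hc) h0
      linarith
    have := aux_ord α ε |x| |y| h0 h2 hε h1 h3 (abs_nonneg _) hxy hx1
    have k : (|x| - |y|) ^ (α + ε) ≤ |x - y| ^ (α + ε) :=
      Real.rpow_le_rpow (by linarith) (abs_sub_abs_le_abs_sub x y) (by linarith)
    rw [Real.rpow_add_of_nonneg (abs_nonneg (x - y)) h0.le hε.le] at k
    linarith
  rcases le_total |s'| |s| with h | h
  · exact key s s' hs h
  · have := key s' s hs' h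
    rw [abs_sub_comm s' s] at this
    linarith [sub_sq_comm (|s| ^ α) (|s'| ^ α)]

/-- For `α₁, α₂ ∈ (0,2)` and `0 < ε < min(α₁, α₂, 2-α₁, 2-α₂)`, there is `C > 0`
such that for all `(s,t) ≠ (s',t')` with `1/2 ≤ |s|^{α₁}+|t|^{α₂} ≤ 1` and
`1/2 ≤ |s'|^{α₁}+|t'|^{α₂} ≤ 1`,
`(√(|s|^{α₁}+|t|^{α₂}) - √(|s'|^{α₁}+|t'|^{α₂}))² ≤ C(|s-s'|^ε + |t-t'|^ε)(|s-s'|^{α₁}+|t-t'|^{α₂})`. -/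
theorem stmt5 (α₁ α₂ ε : ℝ) (hα₁ : α₁ ∈ Set.Ioo (0:ℝ) 2) (hα₂ : α₂ ∈ Set.Ioo (0:ℝ) 2)
    (hε : 0 < ε) (hε' : ε < min (min α₁ α₂) (min (2 - α₁) (2 - α₂))) :
    ∃ C > (0:ℝ), ∀ s t s' t' : ℝ,
      1/2 ≤ |s| ^ α₁ + |t| ^ α₂ → |s| ^ α₁ + |t| ^ α₂ ≤ 1 →
      1/2 ≤ |s'| ^ α₁ + |t'| ^ α₂ → |s'| ^ α₁ + |t'| ^ α₂ ≤ 1 →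
      (s, t) ≠ (s', t') →
      (Real.sqrt (|s| ^ α₁ + |t| ^ α₂) - Real.sqrt (|s'| ^ α₁ + |t'| ^ α₂)) ^ 2 ≤
        C * (|s - s'| ^ ε + |t - t'| ^ ε) * (|s - s'| ^ α₁ + |t - t'| ^ α₂) := by
  obtain ⟨ha, hb⟩ := hα₁
  obtain ⟨hc, hd⟩ := hα₂
  simp only [lt_min_iff] at hε'
  obtain ⟨⟨e1, e2⟩, e3, e4⟩ := hε'
  refine ⟨8, by norm_num, ?_⟩
  intro s t s' t' l1 u1 l2 u2 _
  have p1 : 0 ≤ |s| ^ α₁ := by positivity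
  have p2 : 0 ≤ |t| ^ α₂ := by positivity
  have p3 : 0 ≤ |s'| ^ α₁ := by positivity
  have p4 : 0 ≤ |t'| ^ α₂ := by positivity
  have A := aux_abs α₁ ε s s' ha hb hε e1 e3 (by linarith) (by linarith)
  have B := aux_abs α₂ ε t t' hc hd hε e2 e4 (by linarith) (by linarith)
  have q1 : 0 ≤ |s - s'| ^ ε * |t - t'| ^ α₂ := by positivity
  have q2 : 0 ≤ |t - t'| ^ ε * |s - s'| ^ α₁ := by positivity
  have S : ∀ x y : ℝ, 1/2 ≤ x → 1/2 ≤ y → (Real.sqrt x - Real.sqrt y) ^ 2 ≤ (x - y) ^ 2 := by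
    intro x y hx hy
    have hx2 := Real.sq_sqrt (by linarith : 0 ≤ x)
    have hy2 := Real.sq_sqrt (by linarith : 0 ≤ y)
    have hx0 := Real.sqrt_nonneg x
    have hy0 := Real.sqrt_nonneg y
    have e : (x - y) ^ 2 = (Real.sqrt x - Real.sqrt y) ^ 2 * (Real.sqrt x + Real.sqrt y) ^ 2 := by
      rw [← mul_pow]; congr 1; linarith [hx2, hy2]
    rw [e]
    exact le_mul_of_one_le_right (sq_nonneg _) (by nlinarith [mul_nonneg hx0 hy0])
  refine (S _ _ l1 l2).trans ?_
  nlinarith [sq_nonneg ((|s| ^ α₁ - |s'| ^ α₁) - (|t| ^ α₂ - |t'| ^ α₂))]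
end

section
/- Let Ψ(u) = (2π)^{−1/2} ∫_u^∞ e^{−x²/2} dx denote the tail of the standard normal distribution. Then for every real constant c > 0, lim_{u→∞} u^{c} · Ψ( u (1 − (ln u/(2u))²)^{−1/2} ) / Ψ(u) = 0. -/
open Filter

/-- The tail of the standard normal distribution:
`Ψ(u) = (2π)^{-1/2} ∫_u^∞ e^{-x²/2} dx`. -/
noncomputable def gaussTail (u : ℝ) : ℝ :=
  (2 * Real.pi) ^ (-(1:ℝ)/2) * ∫ x in Set.Ioi u, Real.exp (-x ^ 2 / 2)

lemma gt_pos (u : ℝ) : 0 < gaussTail u := by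
  unfold gaussTail
  have hi : MeasureTheory.Integrable (fun x : ℝ => Real.exp (-x ^ 2 / 2)) := by
    have := integrable_exp_neg_mul_sq (b := 1/2) (by norm_num)
    refine this.congr (Eventually.of_forall fun x => ?_)
    show Real.exp _ = Real.exp _
    congr 1; ring
  refine mul_pos (Real.rpow_pos_of_pos (by positivity) _) ?_
  rw [MeasureTheory.setIntegral_pos_iff_support_of_nonneg_ae
    (Eventually.of_forall fun x => (Real.exp_pos _).le) hi.integrableOn]
  have : Function.support (fun x : ℝ => Real.exp (-x ^ 2 / 2)) = Set.univ := by
    ext x; simp [Real.exp_ne_zero]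
  rw [this]; simp

lemma gt_shift (u s : ℝ) (hs : 0 ≤ s) :
    gaussTail (u + s) ≤ Real.exp (-((u + s) ^ 2 - u ^ 2) / 2) * gaussTail u := by
  unfold gaussTail
  have hi : MeasureTheory.Integrable (fun x : ℝ => Real.exp (-x ^ 2 / 2)) := by
    have := integrable_exp_neg_mul_sq (b := 1/2) (by norm_num)
    refine this.congr (Eventually.of_forall fun x => ?_)
    show Real.exp _ = Real.exp _
    congr 1; ring
  have h1 : ∫ x in Set.Ioi (u + s), Real.exp (-x ^ 2 / 2)
      = ∫ x in Set.Ioi u, Real.exp (-(x + s) ^ 2 / 2) := by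
    have := (MeasureTheory.measurePreserving_add_right MeasureTheory.volume s).setIntegral_preimage_emb
      (measurableEmbedding_addRight s) (fun x => Real.exp (-x ^ 2 / 2)) (Set.Ioi (u + s))
    rw [← this]
    congr 2
    ext x; simp
  have h2 : ∫ x in Set.Ioi u, Real.exp (-(x + s) ^ 2 / 2) ≤
      ∫ x in Set.Ioi u, Real.exp (-((u + s) ^ 2 - u ^ 2) / 2) * Real.exp (-x ^ 2 / 2) := by
    refine MeasureTheory.setIntegral_mono_on (hi.comp_add_right s).integrableOn
      (hi.const_mul _).integrableOn measurableSet_Ioi fun x hx => ?_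
    rw [← Real.exp_add]
    apply Real.exp_le_exp.2
    have hx' : u < x := hx
    nlinarith [mul_nonneg hs (sub_nonneg.2 hx'.le)]
  rw [MeasureTheory.integral_const_mul] at h2
  rw [h1]
  have := mul_le_mul_of_nonneg_left h2
    (Real.rpow_pos_of_pos (x := 2 * Real.pi) (by positivity) (-(1:ℝ)/2)).le
  linarith

/-- For every `c > 0`,
`lim_{u→∞} u^c · Ψ(u(1 - (ln u/(2u))²)^{-1/2}) / Ψ(u) = 0`. -/
theorem stmt8 (c : ℝ) (hc : 0 < c) :
    Tendsto (fun u : ℝ =>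
        u ^ c * gaussTail (u * (1 - (Real.log u / (2 * u)) ^ 2) ^ (-(1:ℝ)/2)) / gaussTail u)
      atTop (nhds 0) := by
  have key : Tendsto (fun u : ℝ => Real.exp (-(Real.log u * (Real.log u / 8 - c)))) atTop (nhds 0) := by
    refine (Real.tendsto_exp_neg_atTop_nhds_zero).comp ?_
    refine Real.tendsto_log_atTop.atTop_mul_atTop₀ ?_
    exact tendsto_atTop_add_const_right _ _ (Real.tendsto_log_atTop.atTop_div_const (by norm_num))
  refine squeeze_zero' ?_ ?_ key
  · filter_upwards [eventually_gt_atTop 1] with u hu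
    have := gt_pos u
    have := gt_pos (u * (1 - (Real.log u / (2 * u)) ^ 2) ^ (-(1:ℝ)/2))
    positivity
  · filter_upwards [eventually_gt_atTop 1] with u hu
    have hu0 : 0 < u := by linarith
    have hl0 : 0 < Real.log u := Real.log_pos hu
    have hl1 : Real.log u < u := by linarith [Real.log_le_sub_one_of_pos hu0]
    set d := Real.log u / (2 * u) with hd
    have hd0 : 0 < d := by positivity
    have hd1 : d < 1 := by rw [hd, div_lt_one (by positivity)]; linarith
    have hdu : d * u = Real.log u / 2 := by rw [hd]; field_simp
    have hq0 : 0 < 1 - d ^ 2 := by nlinarith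
    set r := (1 - d ^ 2) ^ (-(1:ℝ)/2) with hr
    have hr1 : 1 ≤ r := Real.one_le_rpow_of_pos_of_le_one_of_nonpos hq0 (by nlinarith) (by norm_num)
    have hr2 : r ^ 2 * (1 - d ^ 2) = 1 := by
      rw [hr, ← Real.rpow_natCast, ← Real.rpow_mul hq0.le]
      norm_num [Real.rpow_neg_one, hq0.ne']
    have hr3 : 1 + d ^ 2 ≤ r ^ 2 := by nlinarith [mul_nonneg (sq_nonneg d) (show 0 ≤ r ^ 2 - 1 by nlinarith)]
    have h := gt_shift u (u * r - u) (by nlinarith)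
    rw [add_sub_cancel] at h
    have hp := gt_pos u
    have hv : (Real.log u) ^ 2 / 4 ≤ (u * r) ^ 2 - u ^ 2 := by
      have : (d * u) ^ 2 ≤ (u * r) ^ 2 - u ^ 2 := by
        nlinarith [mul_le_mul_of_nonneg_left hr3 (sq_nonneg u)]
      rw [hdu] at this
      linarith
    rw [div_le_iff₀ hp]
    calc u ^ c * gaussTail (u * r)
        ≤ u ^ c * (Real.exp (-((u * r) ^ 2 - u ^ 2) / 2) * gaussTail u) := by gcongr
      _ = Real.exp (Real.log u * c + -((u * r) ^ 2 - u ^ 2) / 2) * gaussTail u := by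
        rw [Real.exp_add, ← Real.rpow_def_of_pos hu0]; ring
      _ ≤ _ := by
        gcongr
        nlinarith
end
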